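/- Let h ≥ 1 and let λ_1, …, λ_h be distinct complex numbers, none of which is an invariant zero of (A,B,C,D). If 𝒱 is an output-nulling subspace admitting a friend F such that the restriction of A+BF to 𝒱 is diagonalizable and every eigenvalue of this restriction belongs to {λ_1, …, λ_h}, then 𝒱 ⊆ W(λ_1) + W(λ_2) + ⋯ + W(λ_h). -/

import Mathlib

open Matrix Submodule

/-- The Rosenbrock matrix `[[A - λI, B], [C, D]]`. -/
noncomputable def rosenbrock {n m p : ℕ} (A : Matrix (Fin n) (Fin n) ℂ)
    (B : Matrix (Fin n) (Fin m) ℂ) (C : Matrix (Fin p) (Fin n) ℂ)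
    (D : Matrix (Fin p) (Fin m) ℂ) (lam : ℂ) :
    Matrix (Fin n ⊕ Fin p) (Fin n ⊕ Fin m) ℂ :=
  Matrix.fromBlocks (A - lam • 1) B C D

/-- `λ` is an invariant zero of `(A,B,C,D)` if the rank of the Rosenbrock matrix at `λ`
is strictly smaller than its normal rank (the max over `μ` of the rank at `μ`). -/
noncomputable def IsInvariantZero {n m p : ℕ} (A : Matrix (Fin n) (Fin n) ℂ)
    (B : Matrix (Fin n) (Fin m) ℂ) (C : Matrix (Fin p) (Fin n) ℂ)
    (D : Matrix (Fin p) (Fin m) ℂ) (lam : ℂ) : Prop :=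
  (rosenbrock A B C D lam).rank < ⨆ μ : ℂ, (rosenbrock A B C D μ).rank

/-- The Rosenbrock pencil subspace `W(λ) = {x | ∃ u, (A - λI)x + Bu = 0 ∧ Cx + Du = 0}`. -/
noncomputable def rosSub {n m p : ℕ} (A : Matrix (Fin n) (Fin n) ℂ)
    (B : Matrix (Fin n) (Fin m) ℂ) (C : Matrix (Fin p) (Fin n) ℂ)
    (D : Matrix (Fin p) (Fin m) ℂ) (lam : ℂ) : Submodule ℂ (Fin n → ℂ) :=
  Submodule.map (LinearMap.fst ℂ (Fin n → ℂ) (Fin m → ℂ))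
    (LinearMap.ker ((((A - lam • 1).mulVecLin).coprod B.mulVecLin).prod
      ((C.mulVecLin).coprod D.mulVecLin)))

/-- A subspace `𝒱` is output-nulling if it has a friend `F`, i.e.
`(A + BF) 𝒱 ⊆ 𝒱` and `𝒱 ⊆ ker (C + DF)`. -/
def IsOutputNulling {n m p : ℕ} (A : Matrix (Fin n) (Fin n) ℂ)
    (B : Matrix (Fin n) (Fin m) ℂ) (C : Matrix (Fin p) (Fin n) ℂ)
    (D : Matrix (Fin p) (Fin m) ℂ) (V : Submodule ℂ (Fin n → ℂ)) : Prop :=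
  ∃ F : Matrix (Fin m) (Fin n) ℂ,
    (∀ x ∈ V, (A + B * F).mulVecLin x ∈ V) ∧ V ≤ LinearMap.ker (C + D * F).mulVecLin

/-- The largest output-nulling subspace `𝒱*`. -/
noncomputable def vStar {n m p : ℕ} (A : Matrix (Fin n) (Fin n) ℂ)
    (B : Matrix (Fin n) (Fin m) ℂ) (C : Matrix (Fin p) (Fin n) ℂ)
    (D : Matrix (Fin p) (Fin m) ℂ) : Submodule ℂ (Fin n → ℂ) :=
  sSup {V : Submodule ℂ (Fin n → ℂ) | IsOutputNulling A B C D V}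

/-- The input-containing sequence: `𝒮_0 = 0`,
`𝒮_{j+1} = {Ax + Bu : x ∈ 𝒮_j, Cx + Du = 0}`. -/
noncomputable def sSeq {n m p : ℕ} (A : Matrix (Fin n) (Fin n) ℂ)
    (B : Matrix (Fin n) (Fin m) ℂ) (C : Matrix (Fin p) (Fin n) ℂ)
    (D : Matrix (Fin p) (Fin m) ℂ) : ℕ → Submodule ℂ (Fin n → ℂ)
  | 0 => ⊥
  | (j + 1) => Submodule.map ((A.mulVecLin).coprod B.mulVecLin)
      (((sSeq A B C D j).prod ⊤) ⊓ LinearMap.ker ((C.mulVecLin).coprod D.mulVecLin))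

/-- Diagonalizable endomorphism: the eigenspaces span the whole space. -/
def IsDiagonalizable {M : Type*} [AddCommGroup M] [Module ℂ M]
    (f : M →ₗ[ℂ] M) : Prop :=
  (⨆ μ : ℂ, Module.End.eigenspace f μ) = ⊤

/-- An eigenvector of `A + BF` lying in `ker (C + DF)` belongs to the Rosenbrock pencil
subspace at its eigenvalue, with input `Fx`. -/
theorem mem_rosSub_of_friend {n m p : ℕ} (A : Matrix (Fin n) (Fin n) ℂ)
    (B : Matrix (Fin n) (Fin m) ℂ) (C : Matrix (Fin p) (Fin n) ℂ)
    (D : Matrix (Fin p) (Fin m) ℂ) (F : Matrix (Fin m) (Fin n) ℂ) {lam : ℂ} {x : Fin n → ℂ}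
    (hx : (A + B * F).mulVecLin x = lam • x) (hCx : (C + D * F).mulVecLin x = 0) :
    x ∈ rosSub A B C D lam := by
  simp only [Matrix.mulVecLin_apply, Matrix.add_mulVec, ← Matrix.mulVec_mulVec] at hx hCx
  refine ⟨(x, F *ᵥ x), ?_, rfl⟩
  have hA : (A - lam • 1) *ᵥ x + B *ᵥ (F *ᵥ x) = 0 := by
    rw [Matrix.sub_mulVec, Matrix.smul_mulVec, Matrix.one_mulVec, sub_add_eq_add_sub, hx, sub_self]
  exact Prod.ext hA hCx

theorem output_nulling_diag_subset_sum_rosSub (n m p : ℕ)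
    (hn : 0 < n) (hm : 0 < m) (hp : 0 < p)
    (A : Matrix (Fin n) (Fin n) ℂ) (B : Matrix (Fin n) (Fin m) ℂ)
    (C : Matrix (Fin p) (Fin n) ℂ) (D : Matrix (Fin p) (Fin m) ℂ)
    (h : ℕ) (hh : 1 ≤ h) (lam : Fin h → ℂ)
    (hdist : Function.Injective lam)
    (hz : ∀ i, ¬ IsInvariantZero A B C D (lam i))
    (V : Submodule ℂ (Fin n → ℂ))
    (F : Matrix (Fin m) (Fin n) ℂ)
    (hinv : ∀ x ∈ V, (A + B * F).mulVecLin x ∈ V)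
    (hker : V ≤ LinearMap.ker (C + D * F).mulVecLin)
    (hdiag : IsDiagonalizable ((A + B * F).mulVecLin.restrict hinv))
    (heig : ∀ μ : ℂ, Module.End.HasEigenvalue ((A + B * F).mulVecLin.restrict hinv) μ →
      μ ∈ Set.range lam) :
    V ≤ ⨆ i, rosSub A B C D (lam i) := by
  have hV : V = ⨆ μ : ℂ, (Module.End.eigenspace
      ((A + B * F).mulVecLin.restrict hinv) μ).map V.subtype := by
    have hdiag' : (⨆ μ : ℂ, Module.End.eigenspace
      ((A + B * F).mulVecLin.restrict hinv) μ) = ⊤ := hdiag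
    rw [← Submodule.map_iSup, hdiag', Submodule.map_subtype_top]
  rw [hV]
  refine iSup_le fun μ => ?_
  by_cases hμ : Module.End.HasEigenvalue ((A + B * F).mulVecLin.restrict hinv) μ
  · obtain ⟨i, rfl⟩ := heig μ hμ
    refine le_trans ?_ (le_iSup (fun i => rosSub A B C D (lam i)) i)
    rintro _ ⟨x, hx, rfl⟩
    exact mem_rosSub_of_friend A B C D F
      (congrArg Subtype.val (Module.End.mem_eigenspace_iff.mp hx)) (hker x.2)
  · rw [Module.End.hasEigenvalue_iff, not_not] at hμ
    rw [hμ, Submodule.map_bot]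
    exact bot_le
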